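/- arXiv:2503.08821 — 2 statements merged into one kernel-verified Lean document; each statement's English description precedes it below -/
import Mathlib

section
/- For every q < 0 and every j ∈ ℕ, S₁(j,q) ≤ 4·S₃(j+2,q). This follows from the geometric fact that if λ'(λ) denotes the second leftmost subinterval of generation j+2 contained in a dyadic interval λ of generation j, then 3λ'(λ) ⊆ λ, hence ℓ³_{λ'(λ)} ≤ ℓ¹_λ. -/
/-- The dyadic interval `λ_{j,k} = [k·2^{-j}, (k+1)·2^{-j})` of generation `j`. -/
noncomputable def dyadic (j : ℕ) (k : ℤ) : Set ℝ :=
  Set.Ico ((k : ℝ) / 2 ^ j) (((k : ℝ) + 1) / 2 ^ j)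

/-- The interval `3λ_{j,k}` with the same center and three times the width. -/
noncomputable def dyadic3 (j : ℕ) (k : ℤ) : Set ℝ :=
  dyadic j (k - 1) ∪ dyadic j k ∪ dyadic j (k + 1)

/-- The 1-leader `ℓ¹_{j,k} = sup { |c_{j',k'}| : λ_{j',k'} ⊆ λ_{j,k} }`. -/
noncomputable def leader1 (c : ℕ → ℤ → ℝ) (j : ℕ) (k : ℤ) : ℝ :=
  sSup { y : ℝ | ∃ j' : ℕ, ∃ k' : ℤ, dyadic j' k' ⊆ dyadic j k ∧ y = |c j' k'| }

/-- The 3-leader `ℓ³_{j,k} = sup { |c_{j',k'}| : λ_{j',k'} ⊆ 3λ_{j,k} }`. -/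
noncomputable def leader3 (c : ℕ → ℤ → ℝ) (j : ℕ) (k : ℤ) : ℝ :=
  sSup { y : ℝ | ∃ j' : ℕ, ∃ k' : ℤ, dyadic j' k' ⊆ dyadic3 j k ∧ y = |c j' k'| }

/-- The structure function `S(j,q) = 2^{-j} ∑_{k=0}^{2^j−1} L(j,k)^q`
built from a multiresolution quantity `L`. -/
noncomputable def structureFn (L : ℕ → ℤ → ℝ) (j : ℕ) (q : ℝ) : ℝ :=
  (2 : ℝ) ^ (-(j : ℝ)) * ∑ k ∈ Finset.range (2 ^ j), (L j (k : ℤ)) ^ q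

/-- The scaling function `ζ(q) = liminf_{j→∞} log S(j,q) / log 2^{-j}`. -/
noncomputable def scalingFn (L : ℕ → ℤ → ℝ) (q : ℝ) : ℝ :=
  Filter.liminf
    (fun j : ℕ => Real.log (structureFn L j q) / Real.log ((2 : ℝ) ^ (-(j : ℝ))))
    Filter.atTop

theorem dyadic_add_two_subset (j : ℕ) {k m : ℤ} (h₁ : 4 * k ≤ m) (h₂ : m + 1 ≤ 4 * k + 4) :
    dyadic (j + 2) m ⊆ dyadic j k := by
  have h₁' : (4 : ℝ) * k ≤ m := by exact_mod_cast h₁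
  have h₂' : (m : ℝ) + 1 ≤ 4 * k + 4 := by exact_mod_cast h₂
  have hp : (0 : ℝ) < 2 ^ j := by positivity
  apply Set.Ico_subset_Ico
  · rw [pow_add, div_le_div_iff₀ hp (by positivity)]
    nlinarith
  · rw [pow_add, div_le_div_iff₀ (by positivity) hp]
    nlinarith

/-- The second leftmost grandchild of a dyadic interval has its triple inside that interval. -/
theorem dyadic3_add_two_subset (j : ℕ) (k : ℤ) :
    dyadic3 (j + 2) (4 * k + 1) ⊆ dyadic j k :=
  Set.union_subset
    (Set.union_subset (dyadic_add_two_subset j (by lia) (by lia))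
      (dyadic_add_two_subset j (by lia) (by lia)))
    (dyadic_add_two_subset j (by lia) (by lia))

theorem dyadic_subset_dyadic3 (j : ℕ) (k : ℤ) : dyadic j k ⊆ dyadic3 j k :=
  fun _ hx => Or.inl (Or.inr hx)

theorem bddAbove_abs_coeff {c : ℕ → ℤ → ℝ} (hbd : ∃ C : ℝ, ∀ (j : ℕ) (k : ℤ), |c j k| ≤ C)
    (A : Set ℝ) :
    BddAbove { y : ℝ | ∃ j' : ℕ, ∃ k' : ℤ, dyadic j' k' ⊆ A ∧ y = |c j' k'| } := by
  obtain ⟨C, hC⟩ := hbd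
  refine ⟨C, ?_⟩
  rintro y ⟨j', k', -, rfl⟩
  exact hC j' k'

theorem leader1_le_leader3 {c : ℕ → ℤ → ℝ} (hbd : ∃ C : ℝ, ∀ (j : ℕ) (k : ℤ), |c j k| ≤ C)
    (j : ℕ) (k : ℤ) : leader1 c j k ≤ leader3 c j k := by
  refine csSup_le_csSup (bddAbove_abs_coeff hbd _) ⟨_, j, k, subset_rfl, rfl⟩ ?_
  rintro y ⟨j', k', h, rfl⟩
  exact ⟨j', k', h.trans (dyadic_subset_dyadic3 j k), rfl⟩

theorem leader3_add_two_le_leader1 {c : ℕ → ℤ → ℝ}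
    (hbd : ∃ C : ℝ, ∀ (j : ℕ) (k : ℤ), |c j k| ≤ C) (j : ℕ) (k : ℤ) :
    leader3 c (j + 2) (4 * k + 1) ≤ leader1 c j k := by
  refine csSup_le_csSup (bddAbove_abs_coeff hbd _)
    ⟨_, j + 2, 4 * k + 1, dyadic_subset_dyadic3 _ _, rfl⟩ ?_
  rintro y ⟨j', k', h, rfl⟩
  exact ⟨j', k', h.trans (dyadic3_add_two_subset j k), rfl⟩

theorem leader3_nonneg (c : ℕ → ℤ → ℝ) (j : ℕ) (k : ℤ) : 0 ≤ leader3 c j k := by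
  refine Real.sSup_nonneg ?_
  rintro y ⟨j', k', -, rfl⟩
  exact abs_nonneg _

/-- For every `q < 0` and every `j`, `S₁(j,q) ≤ 4·S₃(j+2,q)`. -/
theorem structureFn_leader1_le_four_mul (c : ℕ → ℤ → ℝ)
    (hbd : ∃ C : ℝ, ∀ (j : ℕ) (k : ℤ), |c j k| ≤ C)
    (hsupp : ∀ (j : ℕ) (k : ℤ), (k < 0 ∨ (2 : ℤ) ^ j ≤ k) → c j k = 0)
    (hpos : ∀ (j : ℕ) (k : ℤ), 0 ≤ k → k < (2 : ℤ) ^ j → 0 < leader1 c j k)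
    (q : ℝ) (hq : q < 0) (j : ℕ) :
    structureFn (leader1 c) j q ≤ 4 * structureFn (leader3 c) (j + 2) q := by
  have hscale : 4 * (2 : ℝ) ^ (-((j + 2 : ℕ) : ℝ)) = 2 ^ (-(j : ℝ)) := by
    rw [Real.rpow_neg zero_le_two, Real.rpow_neg zero_le_two, Real.rpow_natCast,
      Real.rpow_natCast, pow_add]
    field_simp
    norm_num
  have hinj : Function.Injective fun k : ℕ => 4 * k + 1 := fun a b h => by
    have : 4 * a + 1 = 4 * b + 1 := h
    lia
  unfold structureFn
  rw [← mul_assoc, hscale]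
  refine mul_le_mul_of_nonneg_left ?_ (by positivity)
  calc ∑ k ∈ Finset.range (2 ^ j), leader1 c j (k : ℤ) ^ q
      ≤ ∑ k ∈ Finset.range (2 ^ j), leader3 c (j + 2) ((4 * k + 1 : ℕ) : ℤ) ^ q := by
        refine Finset.sum_le_sum fun k hk => ?_
        have hk' : (k : ℤ) < 2 ^ j := by exact_mod_cast Finset.mem_range.mp hk
        push_cast
        refine Real.rpow_le_rpow_of_nonpos ?_ (leader3_add_two_le_leader1 hbd j k) hq.le
        refine (hpos (j + 2) (4 * k + 1) (by positivity) ?_).trans_le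
          (leader1_le_leader3 hbd _ _)
        rw [pow_add]
        lia
    _ = ∑ m ∈ (Finset.range (2 ^ j)).image fun k : ℕ => (4 * k + 1 : ℕ),
          leader3 c (j + 2) (m : ℤ) ^ q := by
        rw [Finset.sum_image hinj.injOn]
    _ ≤ ∑ m ∈ Finset.range (2 ^ (j + 2)), leader3 c (j + 2) (m : ℤ) ^ q := by
        refine Finset.sum_le_sum_of_subset_of_nonneg (fun m hm => ?_)
          fun m _ _ => Real.rpow_nonneg (leader3_nonneg c _ _) q
        obtain ⟨k, hk, rfl⟩ := Finset.mem_image.mp hm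
        rw [Finset.mem_range] at hk ⊢
        rw [pow_add]
        lia
end

section
/- (Distribution of large leaders for random wavelet series.) For all α > 0 and β > 0 there exist constants A₀ > 0 and C_{α,β} > 0 such that for every A ≥ A₀: 1 − F_{α,β}(A) ≤ C_{α,β}·e^{−A^β}/(β·A^{β−1}). -/
/-- `G_β(t) = 2·κ_β·∫_0^t e^{−x^β} dx` with `κ_β = β/(2·Γ(1/β))`: the probability
that a generalized Gaussian random variable has absolute value at most `t`. -/
noncomputable def genGaussAbsCDF (β t : ℝ) : ℝ :=
  2 * (β / (2 * Real.Gamma (1 / β))) * ∫ x in (0 : ℝ)..t, Real.exp (-x ^ β)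

open Filter Topology MeasureTheory Set

lemma integrableOn_exp_neg_rpow {β : ℝ} (hβ : 0 < β) :
    IntegrableOn (fun x : ℝ => Real.exp (-x ^ β)) (Ioi 0) := by
  simpa using integrableOn_rpow_mul_exp_neg_rpow (p := β) (s := 0) (by norm_num) hβ

lemma continuous_exp_neg_rpow {β : ℝ} (hβ : 0 < β) :
    Continuous (fun x : ℝ => Real.exp (-x ^ β)) :=
  Real.continuous_exp.comp (Real.continuous_rpow_const hβ.le).neg

lemma genGauss_const_pos {β : ℝ} (hβ : 0 < β) : 0 < 2 * (β / (2 * Real.Gamma (1 / β))) := by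
  have := Real.Gamma_pos_of_pos (one_div_pos.mpr hβ)
  positivity

lemma genGaussAbsCDF_hasDerivAt {β : ℝ} (hβ : 0 < β) (t : ℝ) :
    HasDerivAt (genGaussAbsCDF β)
      (2 * (β / (2 * Real.Gamma (1 / β))) * Real.exp (-t ^ β)) t :=
  ((continuous_exp_neg_rpow hβ).integral_hasStrictDerivAt 0 t).hasDerivAt.const_mul _

lemma genGaussAbsCDF_tendsto_one {β : ℝ} (hβ : 0 < β) :
    Tendsto (genGaussAbsCDF β) atTop (𝓝 1) := by
  have h := (intervalIntegral_tendsto_integral_Ioi 0 (integrableOn_exp_neg_rpow hβ)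
    tendsto_id).const_mul (2 * (β / (2 * Real.Gamma (1 / β))))
  have hG := Real.Gamma_pos_of_pos (one_div_pos.mpr hβ)
  rw [integral_exp_neg_rpow hβ, Real.Gamma_add_one (one_div_pos.mpr hβ).ne'] at h
  have hnorm : 2 * (β / (2 * Real.Gamma (1 / β))) * (1 / β * Real.Gamma (1 / β)) = 1 := by
    generalize Real.Gamma (1 / β) = g at hG
    field_simp
  rwa [hnorm] at h

lemma genGaussAbsCDF_monotone {β : ℝ} (hβ : 0 < β) : Monotone (genGaussAbsCDF β) :=
  monotone_of_hasDerivAt_nonneg (genGaussAbsCDF_hasDerivAt hβ) fun _ =>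
    mul_nonneg (genGauss_const_pos hβ).le (Real.exp_pos _).le

lemma genGaussAbsCDF_nonneg {β t : ℝ} (hβ : 0 < β) (ht : 0 ≤ t) : 0 ≤ genGaussAbsCDF β t := by
  simpa [genGaussAbsCDF] using genGaussAbsCDF_monotone hβ ht

lemma genGaussAbsCDF_le_one {β : ℝ} (hβ : 0 < β) (t : ℝ) : genGaussAbsCDF β t ≤ 1 :=
  (genGaussAbsCDF_monotone hβ).ge_of_tendsto (genGaussAbsCDF_tendsto_one hβ) t

lemma tendsto_rpow_mul_exp_neg_rpow {β : ℝ} (hβ : 0 < β) (s : ℝ) :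
    Tendsto (fun t : ℝ => t ^ s * Real.exp (-t ^ β)) atTop (𝓝 0) := by
  have h := (tendsto_rpow_mul_exp_neg_mul_atTop_nhds_zero (s / β) 1 one_pos).comp
    (tendsto_rpow_atTop hβ)
  refine h.congr' ?_
  filter_upwards [eventually_gt_atTop 0] with t ht
  simp only [Function.comp_apply]
  rw [← Real.rpow_mul ht.le, mul_div_cancel₀ _ hβ.ne', neg_one_mul]

lemma one_sub_genGaussAbsCDF_le {β : ℝ} (hβ : 0 < β) :
    ∃ T : ℝ, 1 ≤ T ∧ ∃ K : ℝ, 0 < K ∧ ∀ t : ℝ, T ≤ t →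
      1 - genGaussAbsCDF β t ≤ K * (t ^ (1 - β) * Real.exp (-t ^ β)) := by
  set k := 2 * (β / (2 * Real.Gamma (1 / β)))
  have hk0 : 0 < k := genGauss_const_pos hβ
  obtain ⟨T, hT⟩ := eventually_atTop.mp
    ((tendsto_rpow_atTop hβ).eventually_ge_atTop (2 * (1 - β) / β))
  refine ⟨max T 1, le_max_right _ _, 2 * k / β, by positivity, fun t ht => ?_⟩
  set D : ℝ → ℝ := fun t =>
    1 - genGaussAbsCDF β t - 2 * k / β * (t ^ (1 - β) * Real.exp (-t ^ β)) with hD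
  have hlim : Tendsto D atTop (𝓝 0) := by
    simpa using ((genGaussAbsCDF_tendsto_one hβ).const_sub 1).sub
      ((tendsto_rpow_mul_exp_neg_rpow hβ (1 - β)).const_mul (2 * k / β))
  have hderiv : ∀ x : ℝ, 0 < x → HasDerivAt D
      (-(k * Real.exp (-x ^ β)) - 2 * k / β * (((1 - β) * x ^ (1 - β - 1)) * Real.exp (-x ^ β)
        + x ^ (1 - β) * (Real.exp (-x ^ β) * -(β * x ^ (β - 1))))) x := fun x hx =>
    ((genGaussAbsCDF_hasDerivAt hβ x).const_sub 1).sub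
      (((Real.hasDerivAt_rpow_const (Or.inl hx.ne')).mul
        (Real.hasDerivAt_rpow_const (Or.inl hx.ne')).neg.exp).const_mul _)
  have hpos : ∀ x ∈ Ici (max T 1), 0 < x := fun x hx =>
    one_pos.trans_le ((le_max_right _ _).trans hx)
  have hmono : MonotoneOn D (Ici (max T 1)) := by
    refine monotoneOn_of_deriv_nonneg (convex_Ici _)
      (fun x hx => (hderiv x (hpos x hx)).continuousAt.continuousWithinAt)
      (fun x hx => (hderiv x (hpos x (interior_subset hx))).differentiableAt.differentiableWithinAt)
      fun x hx => ?_
    have hx' := interior_subset hx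
    have hx0 := hpos x hx'
    rw [(hderiv x hx0).deriv]
    have h1 : x ^ (1 - β) * x ^ (β - 1) = 1 := by
      rw [← Real.rpow_add hx0]; simp
    have h2 : x ^ (1 - β - 1) = (x ^ β)⁻¹ := by
      rw [← Real.rpow_neg hx0.le]; congr 1; ring
    have h3 : 2 * (1 - β) ≤ x ^ β * β :=
      (div_le_iff₀ hβ).mp (hT x ((le_max_left _ _).trans hx'))
    have hp : 0 < x ^ β := Real.rpow_pos_of_pos hx0 _
    have h4 : 2 * (1 - β) * (x ^ β)⁻¹ ≤ β := by
      rw [← div_eq_mul_inv, div_le_iff₀ hp]; linarith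
    have key : -(k * Real.exp (-x ^ β)) - 2 * k / β * (((1 - β) * x ^ (1 - β - 1)) *
        Real.exp (-x ^ β) + x ^ (1 - β) * (Real.exp (-x ^ β) * -(β * x ^ (β - 1)))) =
        k / β * Real.exp (-x ^ β) * (β - 2 * (1 - β) * (x ^ β)⁻¹) := by
      rw [h2]
      have : x ^ (1 - β) * (Real.exp (-x ^ β) * -(β * x ^ (β - 1))) =
          -(β * Real.exp (-x ^ β)) := by
        linear_combination (-(β * Real.exp (-x ^ β))) * h1
      rw [this]
      field_simp
      ring
    rw [key]
    have := Real.exp_pos (-x ^ β)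
    exact mul_nonneg (by positivity) (by linarith)
  have hle : D t ≤ 0 := ge_of_tendsto hlim <| by
    filter_upwards [eventually_ge_atTop t] with x hx
    exact hmono ht (ht.trans hx) hx
  simp only [hD] at hle
  linarith

lemma one_sub_prod_pow_le_sum {ι : Type*} (s : Finset ι) (g : ι → ℝ) (m : ι → ℕ)
    (h0 : ∀ i ∈ s, 0 ≤ g i) (h1 : ∀ i ∈ s, g i ≤ 1) :
    1 - ∏ i ∈ s, g i ^ m i ≤ ∑ i ∈ s, (m i : ℝ) * (1 - g i) := by
  classical
  induction s using Finset.induction_on with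
  | empty => simp
  | insert a s ha ih =>
    rw [Finset.prod_insert ha, Finset.sum_insert ha]
    have ih' := ih (fun i hi => h0 i (Finset.mem_insert_of_mem hi))
      fun i hi => h1 i (Finset.mem_insert_of_mem hi)
    have ha0 := h0 a (Finset.mem_insert_self a s)
    have ha1 := h1 a (Finset.mem_insert_self a s)
    have hb : 1 + (m a : ℝ) * (g a - 1) ≤ g a ^ m a := by
      simpa using one_add_mul_le_pow (show (-2 : ℝ) ≤ g a - 1 by linarith) (m a)
    have hP : ∏ i ∈ s, g i ^ m i ≤ 1 := Finset.prod_le_one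
      (fun i hi => pow_nonneg (h0 i (Finset.mem_insert_of_mem hi)) _)
      fun i hi => pow_le_one₀ (h0 i (Finset.mem_insert_of_mem hi))
        (h1 i (Finset.mem_insert_of_mem hi))
    nlinarith [pow_le_one₀ (n := m a) ha0 ha1]

lemma summable_two_rpow_mul_exp_neg {c : ℝ} (hc : 0 < c) (s : ℝ) :
    Summable fun j : ℕ => ((2 : ℝ) ^ j) ^ s * Real.exp (-((2 : ℝ) ^ j) ^ c) := by
  have h := ((tendsto_rpow_mul_exp_neg_rpow hc (s + 1)).comp
    (tendsto_pow_atTop_atTop_of_one_lt (one_lt_two (α := ℝ)))).isBigO_one ℝ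
  refine summable_of_isBigO_nat (summable_geometric_two) ?_
  refine (h.mul (Asymptotics.isBigO_refl (fun j : ℕ => (1 / 2 : ℝ) ^ j) atTop)).congr
    (fun j => ?_) fun j => one_mul _
  have : (0 : ℝ) < 2 ^ j := by positivity
  simp only [Function.comp_apply, one_div, inv_pow]
  rw [Real.rpow_add_one this.ne']
  field_simp

/-- Distribution of large leaders for random wavelet series: for all `α > 0` and
`β > 0`, if `F_{α,β}(A) = ∏_{j=0}^∞ G_β(2^{αj}·A)^{2^j}` (the limit of the partial
products) is the distribution function of the wavelet leader `ℓ¹_{0,0}`, then there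
exist constants `A₀ > 0` and `C_{α,β} > 0` such that for every `A ≥ A₀`:
`1 − F_{α,β}(A) ≤ C_{α,β}·e^{−A^β}/(β·A^{β−1})`. -/
theorem large_leaders_distribution (α β : ℝ) (hα : 0 < α) (hβ : 0 < β)
    (F : ℝ → ℝ)
    (hF : ∀ A : ℝ, 0 < A →
      Filter.Tendsto
        (fun n : ℕ => ∏ j ∈ Finset.range n,
          (genGaussAbsCDF β ((2 : ℝ) ^ (α * (j : ℝ)) * A)) ^ (2 ^ j : ℕ))
        Filter.atTop (nhds (F A))) :
    ∃ A₀ : ℝ, 0 < A₀ ∧ ∃ C : ℝ, 0 < C ∧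
      ∀ A : ℝ, A₀ ≤ A →
        1 - F A ≤ C * Real.exp (-A ^ β) / (β * A ^ (β - 1)) := by
  obtain ⟨T, hT1, K, hK, htail⟩ := one_sub_genGaussAbsCDF_le hβ
  set a : ℕ → ℝ := fun j => ((2 : ℝ) ^ j) ^ (1 + α * (1 - β)) *
    Real.exp (-((2 : ℝ) ^ j) ^ (α * β)) with ha
  have hsum : Summable a := summable_two_rpow_mul_exp_neg (mul_pos hα hβ) _
  have ha0 : ∀ j, 0 < a j := fun j => by positivity
  have hS : 0 < ∑' j, a j := hsum.tsum_pos (fun j => (ha0 j).le) 0 (ha0 0)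
  refine ⟨T, by linarith, β * K * Real.exp 1 * ∑' j, a j, by positivity, fun A hA => ?_⟩
  have hA1 : 1 ≤ A := hT1.trans hA
  have hA0 : 0 < A := by linarith
  have hterm : ∀ j : ℕ, ((2 ^ j : ℕ) : ℝ) * (1 - genGaussAbsCDF β ((2 : ℝ) ^ (α * (j : ℝ)) * A)) ≤
      K * A ^ (1 - β) * Real.exp (-A ^ β) * Real.exp 1 * a j := by
    intro j
    have hq : (1 : ℝ) ≤ 2 ^ j := one_le_pow₀ one_le_two
    have hq0 : (0 : ℝ) < 2 ^ j := by positivity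
    have hscale : (2 : ℝ) ^ (α * (j : ℝ)) = ((2 : ℝ) ^ j) ^ α := by
      rw [mul_comm, Real.rpow_mul zero_le_two, Real.rpow_natCast]
    rw [hscale]
    have hr : 1 ≤ ((2 : ℝ) ^ j) ^ α := Real.one_le_rpow hq hα.le
    have ht := htail (((2 : ℝ) ^ j) ^ α * A) (by nlinarith)
    rw [Real.mul_rpow (by positivity) hA0.le, Real.mul_rpow (by positivity) hA0.le,
      ← Real.rpow_mul hq0.le, ← Real.rpow_mul hq0.le] at ht
    have hexp : Real.exp (-(((2 : ℝ) ^ j) ^ (α * β) * A ^ β)) ≤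
        Real.exp (-A ^ β) * Real.exp 1 * Real.exp (-((2 : ℝ) ^ j) ^ (α * β)) := by
      rw [← Real.exp_add, ← Real.exp_add, Real.exp_le_exp]
      nlinarith [Real.one_le_rpow hA1 hβ.le, Real.one_le_rpow hq (mul_pos hα hβ).le]
    calc _ ≤ ((2 ^ j : ℕ) : ℝ) * (K * (((2 : ℝ) ^ j) ^ (α * (1 - β)) * A ^ (1 - β) *
          (Real.exp (-A ^ β) * Real.exp 1 * Real.exp (-((2 : ℝ) ^ j) ^ (α * β))))) := by
          refine mul_le_mul_of_nonneg_left (ht.trans ?_) (by positivity)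
          gcongr
      _ = _ := by
          simp only [ha]
          rw [Real.rpow_add hq0, Real.rpow_one]
          push_cast
          ring
  have hbound : 1 - F A ≤ K * A ^ (1 - β) * Real.exp (-A ^ β) * Real.exp 1 * ∑' j, a j := by
    refine le_of_tendsto ((hF A hA0).const_sub 1) (Eventually.of_forall fun n => ?_)
    calc _ ≤ _ := one_sub_prod_pow_le_sum (Finset.range n) _ (fun j => 2 ^ j)
          (fun j _ => genGaussAbsCDF_nonneg hβ (by positivity))
          fun j _ => genGaussAbsCDF_le_one hβ _
      _ ≤ _ := Finset.sum_le_sum fun j _ => hterm j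
      _ = _ := (Finset.mul_sum ..).symm
      _ ≤ _ := mul_le_mul_of_nonneg_left (hsum.sum_le_tsum _ fun j _ => (ha0 j).le)
          (by positivity)
  refine hbound.trans_eq ?_
  have hinv : A ^ (1 - β) = (A ^ (β - 1))⁻¹ := by
    rw [← Real.rpow_neg hA0.le, neg_sub]
  have : 0 < A ^ (β - 1) := Real.rpow_pos_of_pos hA0 _
  rw [hinv]
  field_simp
end
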